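/- Let A be an abelian category and P a finite partially ordered set of dimension at most 1 (every chain in P has length at most 1). If A has global homological dimension d, then the abelian category A^P of functors from P to A has global homological dimension at most d + 1... and in particular if d = 2 then gl.dim(A^P) ≤ 3. -/

import Mathlib

open CategoryTheory CategoryTheory.Limits

/-- Projective dimension at most `n`, defined recursively via syzygies. -/
def projDimLE (C : Type*) [Category C] [Abelian C] : ℕ → C → Prop
  | 0, X => Projective X
  | (n + 1), X => Projective X ∨
      ∃ (P : C) (p : P ⟶ X), Epi p ∧ Projective P ∧ projDimLE C n (kernel p)

lemma projDimLE.hasProjectiveDimensionLE {C : Type*} [Category C] [Abelian C] {n : ℕ} {X : C}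
    (h : projDimLE C n X) : HasProjectiveDimensionLE X n := by
  induction n generalizing X with
  | zero => exact (projective_iff_hasProjectiveDimensionLE_zero X).1 h
  | succ n ih =>
    rcases h with h | ⟨Q, p, hp, hQ, hK⟩
    · exact hasProjectiveDimensionLT_of_ge X 1 _ (by lia)
    · have hS : (ShortComplex.mk (kernel.ι p) p (kernel.condition p)).ShortExact :=
        { exact := ShortComplex.exact_kernel p }
      exact hS.hasProjectiveDimensionLT_X₃ (n + 1) (ih hK)
        (hasProjectiveDimensionLT_of_ge Q 1 _ (by lia))

namespace PosetDiagram

variable {A : Type*} [Category A] [Abelian A] {P : Type} [PartialOrder P]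

lemma shortExact_kernel_obj {Q F : P ⥤ A} (p : Q ⟶ F) [Epi p] (z : P) :
    (ShortComplex.mk ((kernel.ι p).app z) (p.app z)
      (by rw [← NatTrans.comp_app, kernel.condition]; rfl)).ShortExact :=
  have hS : (ShortComplex.mk (kernel.ι p) p (kernel.condition p)).ShortExact :=
    { exact := ShortComplex.exact_kernel p }
  hS.map_of_exact ((evaluation P A).obj z)

/-- A pointwise projective diagram all of whose non-identity transition maps start at zero objects
is projective. -/
lemma projective_of_isZero_of_lt {K : P ⥤ A} (hK : ∀ z, Projective (K.obj z))
    (h₀ : ∀ ⦃x z : P⦄, x < z → IsZero (K.obj x)) : Projective K where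
  factors {G H} f e _ := by
    refine ⟨{ app := fun z ↦ Projective.factorThru (f.app z) (e.app z),
              naturality := fun x z g ↦ ?_ }, by ext; simp⟩
    rcases (leOfHom g).eq_or_lt with rfl | hlt
    · obtain rfl : g = 𝟙 _ := Subsingleton.elim _ _
      simp
    · exact (h₀ hlt).eq_of_src _ _

variable [Fintype P]

/-- The diagram freely generated by a family of objects: the coproduct of the left adjoints of
the evaluations, applied to the members of the family. -/
noncomputable def free (M : P → A) : P ⥤ A where
  obj z := ∐ fun x : {x : P // x ≤ z} ↦ M x
  map {z w} f := Sigma.desc fun x ↦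
    Sigma.ι (fun x : {x : P // x ≤ w} ↦ M x) ⟨x.1, x.2.trans (leOfHom f)⟩

/-- The inclusion of a generating object in the free diagram. -/
noncomputable def freeι (M : P → A) {x z : P} (h : x ≤ z) : M x ⟶ (free M).obj z :=
  Sigma.ι (fun x : {x : P // x ≤ z} ↦ M x) ⟨x, h⟩

lemma free_hom_ext {M : P → A} {z : P} {Y : A} {f g : (free M).obj z ⟶ Y}
    (h : ∀ (x : P) (hx : x ≤ z), freeι M hx ≫ f = freeι M hx ≫ g) : f = g :=
  Sigma.hom_ext _ _ fun x ↦ h x.1 x.2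

lemma freeι_map (M : P → A) {x z w : P} (h : x ≤ z) (f : z ⟶ w) :
    freeι M h ≫ (free M).map f = freeι M (h.trans (leOfHom f)) := by
  simp [freeι, free]

lemma freeι_map_assoc (M : P → A) {x z w : P} (h : x ≤ z) (f : z ⟶ w) {Y : A}
    (g : (free M).obj w ⟶ Y) :
    freeι M h ≫ (free M).map f ≫ g = freeι M (h.trans (leOfHom f)) ≫ g := by
  rw [← Category.assoc, freeι_map]

/-- The morphism from a value of a free diagram determined by its restrictions to the generating
objects. -/
noncomputable def freeObjDesc {M : P → A} {z : P} {Y : A} (φ : ∀ x : P, x ≤ z → (M x ⟶ Y)) :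
    (free M).obj z ⟶ Y :=
  Sigma.desc fun x : {x : P // x ≤ z} ↦ φ x.1 x.2

@[simp]
lemma freeι_freeObjDesc {M : P → A} {x z : P} (h : x ≤ z) {Y : A}
    (φ : ∀ x : P, x ≤ z → (M x ⟶ Y)) : freeι M h ≫ freeObjDesc φ = φ x h :=
  Sigma.ι_desc _ _

/-- The morphism from a free diagram determined by its values on the generating objects. -/
noncomputable def freeDesc {M : P → A} {F : P ⥤ A} (φ : ∀ x, M x ⟶ F.obj x) : free M ⟶ F where
  app z := freeObjDesc fun x hx ↦ φ x ≫ F.map (homOfLE hx)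
  naturality z w f := free_hom_ext fun x hx ↦ by
    rw [freeι_map_assoc, freeι_freeObjDesc, ← Category.assoc, freeι_freeObjDesc, Category.assoc,
      ← F.map_comp]
    rfl

@[simp]
lemma freeι_freeDesc_app {M : P → A} {F : P ⥤ A} (φ : ∀ x, M x ⟶ F.obj x) {x z : P}
    (h : x ≤ z) : freeι M h ≫ (freeDesc φ).app z = φ x ≫ F.map (homOfLE h) :=
  freeι_freeObjDesc h fun x hx ↦ φ x ≫ F.map (homOfLE hx)

lemma freeι_freeDesc_app_assoc {M : P → A} {F : P ⥤ A} (φ : ∀ x, M x ⟶ F.obj x) {x z : P}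
    (h : x ≤ z) {Y : A} (g : F.obj z ⟶ Y) :
    freeι M h ≫ (freeDesc φ).app z ≫ g = φ x ≫ F.map (homOfLE h) ≫ g := by
  rw [← Category.assoc, freeι_freeDesc_app, Category.assoc]

lemma projective_free (M : P → A) [∀ x, Projective (M x)] : Projective (free M) where
  factors {G H} f e _ := by
    refine ⟨freeDesc fun x ↦ Projective.factorThru (freeι M le_rfl ≫ f.app x) (e.app x), ?_⟩
    ext z
    refine free_hom_ext fun x hx ↦ ?_
    rw [NatTrans.comp_app, freeι_freeDesc_app_assoc, e.naturality, Projective.factorThru_comp_assoc,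
      Category.assoc, ← f.naturality, freeι_map_assoc]

lemma projective_free_obj (M : P → A) [∀ x, Projective (M x)] (z : P) :
    Projective ((free M).obj z) where
  factors f e _ := ⟨freeObjDesc fun x hx ↦ Projective.factorThru (freeι M hx ≫ f) e,
    free_hom_ext fun x hx ↦ by
      rw [← Category.assoc, freeι_freeObjDesc, Projective.factorThru_comp]⟩

lemma epi_freeDesc {M : P → A} {F : P ⥤ A} (φ : ∀ x, M x ⟶ F.obj x) [∀ x, Epi (φ x)] :
    Epi (freeDesc φ) := by
  have (z : P) : Epi ((freeDesc φ).app z) := by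
    refine epi_of_epi_fac (f := freeι M le_rfl) (h := φ z) ?_
    simp
  exact NatTrans.epi_of_epi_app _

lemma isIso_freeDesc_id_app (F : P ⥤ A) {z : P} (hz : IsMin z) :
    IsIso ((freeDesc fun x ↦ 𝟙 (F.obj x)).app z) := by
  refine ⟨freeι F.obj le_rfl, free_hom_ext fun x hx ↦ ?_, by simp⟩
  obtain rfl := hz.eq_of_le hx
  rw [freeι_freeDesc_app_assoc]
  simp

lemma projDimLE_one_of_projective_obj (hdim : ∀ x y z : P, x < y → y < z → False)
    (F : P ⥤ A) (hF : ∀ z, Projective (F.obj z)) : projDimLE (P ⥤ A) 1 F := by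
  have hp := epi_freeDesc fun x ↦ 𝟙 (F.obj x)
  refine Or.inr ⟨_, freeDesc fun x ↦ 𝟙 (F.obj x), hp, projective_free _, ?_⟩
  refine projective_of_isZero_of_lt (fun z ↦ ?_) fun x z hxz ↦ ?_
  · have := projective_free_obj F.obj z
    exact projective_iff_hasProjectiveDimensionLT_one.2 <|
      (shortExact_kernel_obj (freeDesc fun x ↦ 𝟙 (F.obj x)) z).hasProjectiveDimensionLT_X₁ 1
        (projective_iff_hasProjectiveDimensionLT_one.1 this)
        (hasProjectiveDimensionLT_of_ge (F.obj z) 1 2 (by lia))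
  · refine (shortExact_kernel_obj (freeDesc fun x ↦ 𝟙 (F.obj x)) x).isIso_g_iff.1 ?_
    refine isIso_freeDesc_id_app F fun y hyx ↦ ?_
    rcases hyx.eq_or_lt with rfl | hlt
    · exact le_rfl
    · exact (hdim y x z hlt hxz).elim

lemma projDimLE_succ_of_hasProjectiveDimensionLE_obj [EnoughProjectives A]
    (hdim : ∀ x y z : P, x < y → y < z → False) (n : ℕ) (F : P ⥤ A)
    (hF : ∀ z, HasProjectiveDimensionLE (F.obj z) n) : projDimLE (P ⥤ A) (n + 1) F := by
  induction n generalizing F with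
  | zero =>
    exact projDimLE_one_of_projective_obj hdim F fun z ↦
      (projective_iff_hasProjectiveDimensionLE_zero _).2 (hF z)
  | succ n ih =>
    have hp := epi_freeDesc fun x ↦ Projective.π (F.obj x)
    refine Or.inr ⟨_, freeDesc fun x ↦ Projective.π (F.obj x), hp, projective_free _, ?_⟩
    refine ih _ fun z ↦ ?_
    have := projective_free_obj (fun x ↦ Projective.over (F.obj x)) z
    exact (shortExact_kernel_obj (freeDesc fun x ↦ Projective.π (F.obj x))
      z).hasProjectiveDimensionLT_X₁ (n + 1)
        (hasProjectiveDimensionLT_of_ge ((free fun x ↦ Projective.over (F.obj x)).obj z) 1 (n + 1)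
          (by lia)) (hF z)

end PosetDiagram

theorem diagram_category_global_dimension
    {A : Type*} [Category A] [Abelian A] [EnoughProjectives A]
    (P : Type) [PartialOrder P] [Fintype P]
    (hdim : ∀ x y z : P, x < y → y < z → False)
    (d : ℕ) (hA : ∀ X : A, projDimLE A d X) :
    ∀ F : P ⥤ A, projDimLE (P ⥤ A) (d + 1) F :=
  fun F ↦ PosetDiagram.projDimLE_succ_of_hasProjectiveDimensionLE_obj hdim d F
    fun z ↦ (hA (F.obj z)).hasProjectiveDimensionLE
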